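/- arXiv:1706.08561 — 2 statements merged into one kernel-verified Lean document; each statement's English description precedes it below -/
import Mathlib

section
/- (Toy model, d = 2 logarithmic growth.) There exists a constant C such that for every integer L ≥ 2, | (1/L²) Σ_{(n₁,n₂) ∈ {0,…,L−1}² \ {(0,0)}} 1/( (2 − 2cos(2πn₁/L)) + (2 − 2cos(2πn₂/L)) ) − (1/(2π)) log L | ≤ C. -/
open Real

/-- Averaging the geometric resolvent over all `L`-th roots of unity. -/
theorem IsPrimitiveRoot.sum_inv_one_sub_mul_pow {K : Type*} [Field K] {ζ : K} {L : ℕ}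
    (hζ : IsPrimitiveRoot ζ L) (hL : 0 < L) {r : K} (hr : r ^ L ≠ 1) :
    ∑ k ∈ Finset.range L, (1 - r * ζ ^ k)⁻¹ = L / (1 - r ^ L) := by
  have hr' : 1 - r ^ L ≠ 0 := sub_ne_zero.2 hr.symm
  have hterm (k : ℕ) : (1 - r * ζ ^ k)⁻¹ =
      (∑ j ∈ Finset.range L, r ^ j * (ζ ^ j) ^ k) / (1 - r ^ L) := by
    have hgeom := mul_neg_geom_sum (r * ζ ^ k) L
    have hpow : (r * ζ ^ k) ^ L = r ^ L := by
      rw [mul_pow, ← pow_mul, mul_comm k, pow_mul, hζ.pow_eq_one, one_pow, mul_one]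
    rw [hpow] at hgeom
    have hne : 1 - r * ζ ^ k ≠ 0 := fun h => hr' (by rw [← hgeom, h, zero_mul])
    have hsum : ∑ j ∈ Finset.range L, r ^ j * (ζ ^ j) ^ k =
        ∑ j ∈ Finset.range L, (r * ζ ^ k) ^ j :=
      Finset.sum_congr rfl fun j _ => by rw [mul_pow, ← pow_mul, ← pow_mul, mul_comm j]
    rw [hsum, eq_div_iff hr', ← hgeom, inv_mul_cancel_left₀ hne]
  rw [Finset.sum_congr rfl fun k _ => hterm k, ← Finset.sum_div, Finset.sum_comm]
  congr 1
  rw [Finset.sum_eq_single_of_mem 0 (Finset.mem_range.2 hL)]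
  · simp
  · intro j hj hj0
    rw [← Finset.mul_sum]
    have h1 : ζ ^ j ≠ 1 := hζ.pow_ne_one_of_pos_of_lt hj0 (Finset.mem_range.1 hj)
    have hgeom := mul_neg_geom_sum (ζ ^ j) L
    rw [← pow_mul, mul_comm j, pow_mul, hζ.pow_eq_one, one_pow, sub_self] at hgeom
    rw [(mul_eq_zero.1 hgeom).resolve_left (sub_ne_zero.2 h1.symm), mul_zero]

/-- The Poisson kernel summed over the `L`-th roots of unity. -/
theorem sum_inv_one_add_sq_sub_cos {L : ℕ} (hL : 0 < L) {r : ℝ} (h0 : 0 ≤ r) (h1 : r < 1) :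
    ∑ k ∈ Finset.range L, 1 / (1 + r ^ 2 - 2 * r * cos (2 * π * k / L)) =
      L * (1 + r ^ L) / ((1 - r ^ 2) * (1 - r ^ L)) := by
  have hrL : r ^ L < 1 := pow_lt_one₀ h0 h1 hL.ne'
  have hr2 : 0 < 1 - r ^ 2 := by nlinarith
  have key := (Complex.isPrimitiveRoot_exp L hL.ne').sum_inv_one_sub_mul_pow hL (r := (r : ℂ))
    (by exact_mod_cast hrL.ne)
  have hre := congrArg Complex.re key
  rw [Complex.re_sum] at hre
  have hrhs : ((L : ℂ) / (1 - (r : ℂ) ^ L)).re = L / (1 - r ^ L) := by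
    rw [show (L : ℂ) / (1 - (r : ℂ) ^ L) = ((L / (1 - r ^ L) : ℝ) : ℂ) by push_cast; rfl,
      Complex.ofReal_re]
  have hterm (k : ℕ) : 1 / (1 + r ^ 2 - 2 * r * cos (2 * π * k / L)) =
      (2 * ((1 - r * Complex.exp (2 * π * Complex.I / L) ^ k)⁻¹).re - 1) / (1 - r ^ 2) := by
    have hexp : Complex.exp (2 * π * Complex.I / L) ^ k =
        Complex.exp ((2 * π * k / L : ℝ) * Complex.I) := by
      rw [← Complex.exp_nat_mul]
      congr 1
      push_cast
      ring
    rw [hexp, Complex.inv_re, Complex.normSq_apply]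
    simp only [Complex.sub_re, Complex.one_re, Complex.sub_im, Complex.one_im, Complex.re_ofReal_mul,
      Complex.im_ofReal_mul, Complex.exp_ofReal_mul_I_re, Complex.exp_ofReal_mul_I_im]
    set x : ℝ := 2 * π * k / L
    have hD : (1 - r * cos x) * (1 - r * cos x) + (0 - r * sin x) * (0 - r * sin x) =
        1 + r ^ 2 - 2 * r * cos x := by
      linear_combination r ^ 2 * sin_sq_add_cos_sq x
    have hpos : 0 < 1 + r ^ 2 - 2 * r * cos x := by nlinarith [cos_le_one x]
    have hnum : 2 * ((1 - r * cos x) / (1 + r ^ 2 - 2 * r * cos x)) - 1 =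
        (1 - r ^ 2) / (1 + r ^ 2 - 2 * r * cos x) := by
      rw [eq_div_iff hpos.ne', sub_mul, mul_assoc, div_mul_cancel₀ _ hpos.ne']
      ring
    rw [hD, hnum, div_right_comm, div_self hr2.ne']
  rw [Finset.sum_congr rfl fun k _ => hterm k, ← Finset.sum_div, Finset.sum_sub_distrib,
    ← Finset.mul_sum, hre, hrhs]
  have : 1 - r ^ L ≠ 0 := by linarith
  simp only [Finset.sum_const, Finset.card_range, nsmul_eq_mul]
  field_simp
  ring

/-- One row of the torus sum, compared with its main term. -/
theorem abs_sum_inv_two_add_sub_cos_sub_le {L : ℕ} (hL : 0 < L) {s : ℝ} (h0 : 0 < s)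
    (h1 : s ≤ 1) :
    |∑ k ∈ Finset.range L, 1 / (4 * s ^ 2 + (2 - 2 * cos (2 * π * k / L))) - L / 4 * (1 / s)| ≤
      L / 4 + 1 / 4 * (1 / s ^ 2) := by
  set w := √(1 + s ^ 2)
  have hw2 : w ^ 2 = 1 + s ^ 2 := sq_sqrt (by positivity)
  have hw1 : 1 ≤ w := one_le_sqrt.2 (by nlinarith)
  have hws : s < w := by nlinarith
  have hL0 : (0 : ℝ) < L := by exact_mod_cast hL
  set q := (w + s) ^ 2
  set r := (w - s) ^ 2
  have hq : 1 + 2 * s ≤ q := by nlinarith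
  have hrq : r * q = 1 := by
    simp only [r, q]
    linear_combination (w ^ 2 - s ^ 2 + 1) * hw2
  have hr0 : 0 < r := by
    have : 0 < w - s := by linarith
    positivity
  have hr1 : r < 1 := by nlinarith
  have hsum : 1 + r ^ 2 = r * (2 + 4 * s ^ 2) := by
    have : r + q = 2 + 4 * s ^ 2 := by simp only [r, q]; linear_combination 2 * hw2
    rw [← this]
    linear_combination -hrq
  have hdiff : 1 - r ^ 2 = r * (4 * s * w) := by
    have : q - r = 4 * s * w := by simp only [r, q]; ring
    rw [← this]
    linear_combination -hrq
  have hQ : 1 + L * (2 * s) ≤ q ^ L := by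
    calc 1 + L * (2 * s) ≤ (1 + 2 * s) ^ L := one_add_mul_le_pow (by linarith) L
      _ ≤ q ^ L := by gcongr
  have hRQ : r ^ L * q ^ L = 1 := by rw [← mul_pow, hrq, one_pow]
  have hLs : 0 < L * s := by positivity
  have hQ1 : 0 < q ^ L - 1 := by linarith
  have hR1 : 0 < 1 - r ^ L := by linarith [pow_lt_one₀ hr0.le hr1 hL.ne']
  have hrow : ∑ k ∈ Finset.range L, 1 / (4 * s ^ 2 + (2 - 2 * cos (2 * π * k / L))) =
      L / (4 * s * w) * (1 + 2 / (q ^ L - 1)) := by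
    have hP := sum_inv_one_add_sq_sub_cos hL hr0.le hr1
    have hterm (k : ℕ) : 1 / (4 * s ^ 2 + (2 - 2 * cos (2 * π * k / L))) =
        r * (1 / (1 + r ^ 2 - 2 * r * cos (2 * π * k / L))) := by
      rw [hsum, show r * (2 + 4 * s ^ 2) - 2 * r * cos (2 * π * k / L) =
        r * (4 * s ^ 2 + (2 - 2 * cos (2 * π * k / L))) by ring, one_div, one_div, mul_inv,
        mul_inv_cancel_left₀ hr0.ne']
    rw [Finset.sum_congr rfl fun k _ => hterm k, ← Finset.mul_sum, hP, hdiff]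
    have hw0 : 0 < w := by linarith
    have hcoth : (1 + r ^ L) / (1 - r ^ L) = 1 + 2 / (q ^ L - 1) := by
      field_simp
      linear_combination 2 * hRQ
    rw [← hcoth]
    field_simp
  have hw0 : 0 < w := by linarith
  have hlow : 1 / s - 1 ≤ 1 / (s * w) := by
    have : w ≤ 1 + s := by nlinarith
    rw [le_div_iff₀ (by positivity)]
    field_simp
    nlinarith
  have hupp : 1 / (s * w) ≤ 1 / s := by
    gcongr
    nlinarith
  have herr0 : 0 ≤ 2 / (q ^ L - 1) := by positivity
  have herr : 2 / (q ^ L - 1) ≤ 1 / (L * s) := by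
    rw [div_le_div_iff₀ hQ1 hLs]
    linarith
  have hA : L / (4 * s * w) = L / 4 * (1 / (s * w)) := by field_simp
  rw [hrow, hA, abs_le]
  have hprod : L / 4 * (1 / (s * w)) * (2 / (q ^ L - 1)) ≤ 1 / 4 * (1 / s ^ 2) := by
    calc L / 4 * (1 / (s * w)) * (2 / (q ^ L - 1)) ≤ L / 4 * (1 / s) * (1 / (L * s)) := by gcongr
      _ = 1 / 4 * (1 / s ^ 2) := by field_simp
  have hprod0 : 0 ≤ L / 4 * (1 / (s * w)) * (2 / (q ^ L - 1)) := by positivity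
  have hs2 : 0 < 1 / s ^ 2 := by positivity
  constructor
  · nlinarith [mul_le_mul_of_nonneg_left hlow (by positivity : (0 : ℝ) ≤ L / 4)]
  · nlinarith [mul_le_mul_of_nonneg_left hupp (by positivity : (0 : ℝ) ≤ L / 4)]

theorem sum_one_div_succ_sq_le_two (N : ℕ) :
    ∑ i ∈ Finset.range N, 1 / ((i : ℝ) + 1) ^ 2 ≤ 2 := by
  have h : ∑ i ∈ Finset.range (N + 1), 1 / ((i : ℝ) + 1) ^ 2 ≤ 2 - 1 / ((N : ℝ) + 1) := by
    induction N with
    | zero => norm_num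
    | succ n ih =>
      rw [Finset.sum_range_succ]
      have : 1 / ((n : ℝ) + 1 + 1) ^ 2 ≤ 1 / ((n : ℝ) + 1) - 1 / ((n : ℝ) + 1 + 1) := by
        rw [div_sub_div _ _ (by positivity) (by positivity),
          div_le_div_iff₀ (by positivity) (by positivity)]
        nlinarith
      push_cast
      linarith
  rw [Finset.sum_range_succ] at h
  have h1 : 0 < 1 / ((N : ℝ) + 1) := by positivity
  have h2 : 0 ≤ 1 / ((N : ℝ) + 1) ^ 2 := by positivity
  linarith

theorem sin_pi_mul_div_pos {N i : ℕ} (hi : i < N) :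
    0 < sin (π * ((i : ℝ) + 1) / ((N : ℝ) + 1)) := by
  have hi' : (i : ℝ) + 1 ≤ N := by exact_mod_cast hi
  apply sin_pos_of_pos_of_lt_pi
  · positivity
  · rw [div_lt_iff₀ (by positivity)]
    gcongr

theorem sum_one_div_sin_sq_le (N : ℕ) :
    ∑ i ∈ Finset.range N, 1 / sin (π * ((i : ℝ) + 1) / ((N : ℝ) + 1)) ^ 2 ≤
      ((N : ℝ) + 1) ^ 2 := by
  have hterm : ∀ i ∈ Finset.range N, 1 / sin (π * ((i : ℝ) + 1) / ((N : ℝ) + 1)) ^ 2 ≤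
      ((N : ℝ) + 1) ^ 2 / 4 * (1 / ((i : ℝ) + 1) ^ 2 + 1 / (((N - 1 - i : ℕ) : ℝ) + 1) ^ 2) := by
    intro i hi
    have hi := Finset.mem_range.1 hi
    have hcast : ((N - 1 - i : ℕ) : ℝ) + 1 = N - i := by
      have : N - 1 - i + 1 + i = N := by omega
      have : ((N - 1 - i : ℕ) : ℝ) + 1 + i = N := by exact_mod_cast this
      linarith
    have hi' : (i : ℝ) + 1 ≤ N := by exact_mod_cast hi
    rw [hcast]
    have hb : 0 < (N : ℝ) - i := by linarith
    have bound {a : ℝ} (ha : 0 < a) (hN : 2 * a ≤ N + 1) :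
        1 / sin (π * a / ((N : ℝ) + 1)) ^ 2 ≤ ((N : ℝ) + 1) ^ 2 / 4 * (1 / a ^ 2) := by
      have hx : π * a / ((N : ℝ) + 1) ≤ π / 2 := by
        rw [div_le_div_iff₀ (by positivity) (by norm_num)]
        nlinarith [pi_pos]
      have hs := mul_le_sin (by positivity) hx
      have he : 2 / π * (π * a / ((N : ℝ) + 1)) = 2 * a / (N + 1) := by field_simp
      rw [he] at hs
      calc 1 / sin (π * a / ((N : ℝ) + 1)) ^ 2 ≤ 1 / (2 * a / (N + 1)) ^ 2 := by gcongr
        _ = ((N : ℝ) + 1) ^ 2 / 4 * (1 / a ^ 2) := by field_simp; norm_num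
    rcases le_total (2 * ((i : ℝ) + 1)) (N + 1) with h | h
    · refine (bound (by positivity) h).trans ?_
      gcongr
      have : 0 ≤ 1 / ((N : ℝ) - i) ^ 2 := by positivity
      linarith
    · have hrefl : sin (π * ((i : ℝ) + 1) / ((N : ℝ) + 1)) =
          sin (π * ((N : ℝ) - i) / ((N : ℝ) + 1)) := by
        rw [← sin_pi_sub]
        congr 1
        field_simp
        ring
      rw [hrefl]
      refine (bound hb (by linarith)).trans ?_
      gcongr
      have : 0 ≤ 1 / ((i : ℝ) + 1) ^ 2 := by positivity
      linarith
  refine (Finset.sum_le_sum hterm).trans ?_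
  rw [← Finset.mul_sum, Finset.sum_add_distrib,
    Finset.sum_range_reflect (fun i : ℕ => 1 / ((i : ℝ) + 1) ^ 2) N]
  nlinarith [sum_one_div_succ_sq_le_two N, sq_nonneg ((N : ℝ) + 1)]

/-- Folding the cosecant sum into a cotangent sum over the first quadrant. -/
theorem sum_one_div_sin_eq_sum_cot (N : ℕ) :
    ∑ i ∈ Finset.range N, 1 / sin (π * ((i : ℝ) + 1) / ((N : ℝ) + 1)) =
      ∑ i ∈ Finset.range N, cot (π * ((i : ℝ) + 1) / (2 * ((N : ℝ) + 1))) := by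
  set c : ℕ → ℝ := fun i => cot (π * ((i : ℝ) + 1) / (2 * ((N : ℝ) + 1)))
  have hterm : ∀ i ∈ Finset.range N, 1 / sin (π * ((i : ℝ) + 1) / ((N : ℝ) + 1)) =
      (c i + c (N - 1 - i)) / 2 := by
    intro i hi
    have hi := Finset.mem_range.1 hi
    have hcast : ((N - 1 - i : ℕ) : ℝ) + 1 = N - i := by
      have : N - 1 - i + 1 + i = N := by omega
      have : ((N - 1 - i : ℕ) : ℝ) + 1 + i = N := by exact_mod_cast this
      linarith
    have hpos := sin_pi_mul_div_pos hi
    simp only [c, hcast]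
    set x := π * ((i : ℝ) + 1) / (2 * ((N : ℝ) + 1)) with hx
    have h2 : π * ((i : ℝ) + 1) / ((N : ℝ) + 1) = 2 * x := by rw [hx]; field_simp
    have hrefl : π * ((N : ℝ) - i) / (2 * ((N : ℝ) + 1)) = π / 2 - x := by
      rw [hx]; field_simp; ring
    rw [h2, sin_two_mul] at hpos
    rw [h2, sin_two_mul]
    have hs : sin x ≠ 0 := by rintro h; simp [h] at hpos
    have hc : cos x ≠ 0 := by rintro h; simp [h] at hpos
    rw [hrefl, cot_eq_cos_div_sin, cot_eq_cos_div_sin, cos_pi_div_two_sub, sin_pi_div_two_sub]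
    field_simp
    linear_combination -sin_sq_add_cos_sq x
  rw [Finset.sum_congr rfl hterm, ← Finset.sum_div, Finset.sum_add_distrib,
    Finset.sum_range_reflect c N]
  ring

theorem abs_cot_sub_inv_le {x : ℝ} (h0 : 0 < x) (h1 : x < π / 2) : |cot x - 1 / x| ≤ x / 2 := by
  have hs : 0 < sin x := sin_pos_of_pos_of_lt_pi h0 (by linarith)
  have hc : 0 < cos x := cos_pos_of_mem_Ioo ⟨by linarith, h1⟩
  have ht : x * cos x ≤ sin x := by
    have := lt_tan h0 h1
    rw [tan_eq_sin_div_cos, lt_div_iff₀ hc] at this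
    exact this.le
  rw [cot_eq_cos_div_sin, abs_le]
  constructor
  · have h2 : cos x / x ≤ cos x / sin x := by
      gcongr
      exact sin_le h0.le
    have h3 : 1 / x - x / 2 ≤ cos x / x := by
      rw [le_div_iff₀ h0, sub_mul, one_div_mul_cancel h0.ne']
      nlinarith [one_sub_sq_div_two_le_cos (x := x)]
    linarith
  · have : cos x / sin x ≤ 1 / x := by
      rw [div_le_div_iff₀ hs h0]
      linarith
    linarith

theorem abs_sum_one_div_sin_sub_le (N : ℕ) :
    |∑ i ∈ Finset.range N, 1 / sin (π * ((i : ℝ) + 1) / ((N : ℝ) + 1)) -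
      2 * ((N : ℝ) + 1) / π * harmonic N| ≤ (N : ℝ) + 1 := by
  have hH : 2 * ((N : ℝ) + 1) / π * harmonic N =
      ∑ i ∈ Finset.range N, 1 / (π * ((i : ℝ) + 1) / (2 * ((N : ℝ) + 1))) := by
    simp only [harmonic]
    push_cast
    rw [Finset.mul_sum]
    refine Finset.sum_congr rfl fun i _ => ?_
    field_simp
  rw [sum_one_div_sin_eq_sum_cot, hH, ← Finset.sum_sub_distrib]
  refine (Finset.abs_sum_le_sum_abs _ _).trans ?_
  have hterm : ∀ i ∈ Finset.range N, |cot (π * ((i : ℝ) + 1) / (2 * ((N : ℝ) + 1))) -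
      1 / (π * ((i : ℝ) + 1) / (2 * ((N : ℝ) + 1)))| ≤ 1 := by
    intro i hi
    have hi' : (i : ℝ) + 1 ≤ N := by exact_mod_cast Finset.mem_range.1 hi
    have hlt : π * ((i : ℝ) + 1) / (2 * ((N : ℝ) + 1)) < π / 2 := by
      rw [div_lt_div_iff₀ (by positivity) (by norm_num)]
      nlinarith [pi_pos]
    refine (abs_cot_sub_inv_le (by positivity) hlt).trans ?_
    linarith [pi_le_four]
  refine (Finset.sum_le_sum hterm).trans ?_
  simp

/-- **Toy model, `d = 2` logarithmic growth.** There exists a constant `C` such that for every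
integer `L ≥ 2`, the normalized trace of the pseudoinverse of the Laplacian of the 2-dimensional
discrete torus of side `L` differs from `(1/(2π)) log L` by at most `C`. -/
theorem torus2_laplacian_trace_log_growth :
    ∃ C : ℝ, ∀ L : ℕ, 2 ≤ L →
      |((1 : ℝ) / (L : ℝ) ^ 2) *
          ∑ p ∈ (Finset.range L ×ˢ Finset.range L).erase (0, 0),
            1 / ((2 - 2 * Real.cos (2 * π * p.1 / L)) + (2 - 2 * Real.cos (2 * π * p.2 / L))) -
        (1 / (2 * π)) * Real.log L| ≤ C := by
  refine ⟨2, fun L hL => ?_⟩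
  obtain ⟨N, rfl⟩ : ∃ N, L = N + 1 := ⟨L - 1, by omega⟩
  have hN : (1 : ℝ) ≤ N := by exact_mod_cast (by omega : 1 ≤ N)
  rw [Finset.sum_erase _ (by simp), Finset.sum_product, Finset.sum_range_succ']
  have hcos (i : ℕ) : 2 - 2 * cos (2 * π * ((i + 1 : ℕ) : ℝ) / ((N + 1 : ℕ) : ℝ)) =
      4 * sin (π * ((i : ℝ) + 1) / ((N : ℝ) + 1)) ^ 2 := by
    rw [show 2 * π * ((i + 1 : ℕ) : ℝ) / ((N + 1 : ℕ) : ℝ) =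
      2 * (π * ((i : ℝ) + 1) / ((N : ℝ) + 1)) by push_cast; ring, cos_two_mul, cos_sq']
    ring
  have hzero : ∑ j ∈ Finset.range (N + 1), 1 / ((2 - 2 * cos (2 * π * ((0 : ℕ) : ℝ) /
      ((N + 1 : ℕ) : ℝ))) + (2 - 2 * cos (2 * π * (j : ℝ) / ((N + 1 : ℕ) : ℝ)))) =
      1 / 4 * ∑ i ∈ Finset.range N, 1 / sin (π * ((i : ℝ) + 1) / ((N : ℝ) + 1)) ^ 2 := by
    rw [Finset.sum_range_succ', Finset.mul_sum]
    simp only [hcos]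
    simp [mul_comm]
  simp only [hcos, hzero]
  set s : ℕ → ℝ := fun i => sin (π * ((i : ℝ) + 1) / ((N : ℝ) + 1))
  have hrows : |∑ i ∈ Finset.range N, ∑ j ∈ Finset.range (N + 1),
        1 / (4 * s i ^ 2 + (2 - 2 * cos (2 * π * (j : ℝ) / ((N + 1 : ℕ) : ℝ)))) -
      ((N : ℝ) + 1) / 4 * ∑ i ∈ Finset.range N, 1 / s i| ≤
      N * (((N : ℝ) + 1) / 4) + 1 / 4 * ∑ i ∈ Finset.range N, 1 / s i ^ 2 := by
    rw [Finset.mul_sum, ← Finset.sum_sub_distrib]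
    refine (Finset.abs_sum_le_sum_abs _ _).trans ?_
    have := Finset.sum_le_sum fun i (hi : i ∈ Finset.range N) =>
      abs_sum_inv_two_add_sub_cos_sub_le N.succ_pos
        (sin_pi_mul_div_pos (Finset.mem_range.1 hi)) (sin_le_one _)
    rw [Finset.sum_add_distrib, ← Finset.mul_sum] at this
    simpa [s] using this
  have hsq := sum_one_div_sin_sq_le N
  have hsin := abs_sum_one_div_sin_sub_le N
  have hsq0 : 0 ≤ ∑ i ∈ Finset.range N, 1 / s i ^ 2 :=
    Finset.sum_nonneg fun i _ => by positivity
  have hlog1 : log ((N + 1 : ℕ) : ℝ) ≤ harmonic N := log_add_one_le_harmonic N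
  have hlog2 : (harmonic N : ℝ) ≤ 1 + log ((N + 1 : ℕ) : ℝ) := by
    refine (harmonic_le_one_add_log N).trans ?_
    gcongr
    simp
  change ∑ i ∈ Finset.range N, 1 / s i ^ 2 ≤ _ at hsq
  change |∑ i ∈ Finset.range N, 1 / s i - _| ≤ _ at hsin
  set A := ∑ i ∈ Finset.range N, ∑ j ∈ Finset.range (N + 1),
        1 / (4 * s i ^ 2 + (2 - 2 * cos (2 * π * (j : ℝ) / ((N + 1 : ℕ) : ℝ))))
  change |1 / ((N + 1 : ℕ) : ℝ) ^ 2 * (A + 1 / 4 * ∑ i ∈ Finset.range N, 1 / s i ^ 2) - _| ≤ _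
  set B := ∑ i ∈ Finset.range N, 1 / s i
  set D := ∑ i ∈ Finset.range N, 1 / s i ^ 2
  set H : ℝ := ((harmonic N : ℚ) : ℝ)
  set l := log ((N + 1 : ℕ) : ℝ)
  have hM : ((N + 1 : ℕ) : ℝ) = (N : ℝ) + 1 := by push_cast; rfl
  rw [hM]
  set M : ℝ := (N : ℝ) + 1 with hMdef
  have hM0 : 0 < M := by positivity
  have hdecomp : 1 / M ^ 2 * (A + 1 / 4 * D) - 1 / (2 * π) * l =
      (A - M / 4 * B + 1 / 4 * D + M / 4 * (B - 2 * M / π * H)) / M ^ 2 +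
        1 / (2 * π) * (H - l) := by
    field_simp
    ring
  have hpi : 1 / (2 * π) ≤ 1 / 2 := by
    gcongr
    linarith [pi_gt_three]
  have hpi0 : 0 < 1 / (2 * π) := by positivity
  have hmain : |(A - M / 4 * B + 1 / 4 * D + M / 4 * (B - 2 * M / π * H)) / M ^ 2| ≤ 1 := by
    rw [abs_div, abs_of_pos (by positivity : 0 < M ^ 2), div_le_one (by positivity)]
    have hB : |M / 4 * (B - 2 * M / π * H)| ≤ M ^ 2 / 4 := by
      rw [abs_mul, abs_of_pos (by positivity)]
      nlinarith
    have hNM : (N : ℝ) * (M / 4) ≤ M ^ 2 / 4 := by nlinarith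
    rw [abs_le] at hrows hB ⊢
    constructor <;> linarith [hrows.1, hrows.2, hB.1, hB.2]
  rw [hdecomp]
  rw [abs_le] at hmain ⊢
  constructor <;> nlinarith [hmain.1, hmain.2]
end

section
/- (Toy model, d ≥ 3 convergence of the normalized Laplacian trace.) Fix an integer d ≥ 3. The sequence a_L = (1/L^d) Σ_{n ∈ {0,…,L−1}^d \ {0}} 1/( Σ_{i=1}^d (2 − 2cos(2πn_i/L)) ) converges, as L → ∞, to a finite limit C(d) (which equals the integral over [0,2π]^d of 1/Σ_i(2−2cos(p_i)) with respect to normalized Lebesgue measure). -/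
open Real MeasureTheory Filter

/-- On `[0, 1)ᵈ` the map `x ↦ ⌊L x⌋` is constant on the cells of a grid of mesh `1 / L`. -/
theorem setIntegral_unitCube_comp_floor {d L : ℕ} (hL : 0 < L) (F : (Fin d → ℕ) → ℝ) :
    ∫ x in Set.univ.pi (fun _ : Fin d => Set.Ico (0 : ℝ) 1), F (fun i => ⌊x i * L⌋₊) =
      (1 : ℝ) / (L : ℝ) ^ d * ∑ n ∈ Fintype.piFinset fun _ : Fin d => Finset.range L, F n := by
  have hL' : (0 : ℝ) < L := by exact_mod_cast hL
  let cell : (Fin d → ℕ) → Set (Fin d → ℝ) := fun n =>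
    Set.univ.pi fun i => Set.Ico ((n i : ℝ) / L) ((n i + 1 : ℝ) / L)
  have mem_cell : ∀ n x, x ∈ cell n ↔ ∀ i, (n i : ℝ) ≤ x i * L ∧ x i * L < n i + 1 := by
    intro n x
    simp only [cell, Set.mem_univ_pi, Set.mem_Ico, div_le_iff₀ hL', lt_div_iff₀ hL']
  have floor_eq : ∀ n x, x ∈ cell n → (fun i => ⌊x i * L⌋₊) = n := by
    intro n x hx
    rw [mem_cell] at hx
    funext i
    exact (Nat.floor_eq_iff ((Nat.cast_nonneg _).trans (hx i).1)).2 (hx i)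
  have hmeas : ∀ n, MeasurableSet (cell n) := fun n =>
    MeasurableSet.univ_pi fun i => measurableSet_Ico
  have hvol : ∀ n, volume.real (cell n) = 1 / (L : ℝ) ^ d := by
    intro n
    have hle : (fun i => (n i : ℝ) / L) ≤ fun i => ((n i + 1 : ℝ) / L) := by
      intro i
      show (n i : ℝ) / L ≤ (n i + 1 : ℝ) / L
      gcongr
      linarith
    rw [measureReal_def, Real.volume_pi_Ico_toReal hle]
    have : ∀ i, ((n i + 1 : ℝ) / L) - (n i : ℝ) / L = 1 / L := fun i => by ring
    simp [this]
  have hunion : Set.univ.pi (fun _ : Fin d => Set.Ico (0 : ℝ) 1) =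
      ⋃ n ∈ Fintype.piFinset fun _ : Fin d => Finset.range L, cell n := by
    ext x
    simp only [Set.mem_iUnion, Set.mem_univ_pi, Set.mem_Ico, Fintype.mem_piFinset,
      Finset.mem_range, mem_cell, exists_prop]
    constructor
    · intro hx
      have hx0 : ∀ i, 0 ≤ x i * L := fun i => mul_nonneg (hx i).1 hL'.le
      refine ⟨fun i => ⌊x i * L⌋₊, fun i => ?_, fun i =>
        ⟨Nat.floor_le (hx0 i), Nat.lt_floor_add_one _⟩⟩
      rw [Nat.floor_lt (hx0 i)]
      nlinarith [(hx i).2]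
    · rintro ⟨n, hn, hx⟩ i
      have h1 : (n i + 1 : ℝ) ≤ L := by exact_mod_cast hn i
      have h2 : (0 : ℝ) ≤ n i := Nat.cast_nonneg _
      constructor
      · exact nonneg_of_mul_nonneg_left (h2.trans (hx i).1) hL'
      · by_contra! h
        nlinarith [(hx i).2]
  have hcongr : ∀ n, Set.EqOn (fun x : Fin d → ℝ => F (fun i => ⌊x i * L⌋₊)) (fun _ => F n)
      (cell n) := by
    intro n x hx
    show F _ = F n
    rw [floor_eq n x hx]
  rw [hunion, integral_biUnion_finset _ (fun n _ => hmeas n), Finset.mul_sum]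
  · refine Finset.sum_congr rfl fun n _ => ?_
    rw [setIntegral_congr_fun (hmeas n) (hcongr n), setIntegral_const, hvol, smul_eq_mul]
  · intro m _ n _ hmn
    refine Set.disjoint_left.2 fun x hm hn => hmn ?_
    rw [← floor_eq m x hm, floor_eq n x hn]
  · intro n _
    rw [integrableOn_congr_fun (hcongr n) (hmeas n)]
    refine integrableOn_const ?_
    rw [Real.volume_pi_Ico]
    exact (ENNReal.prod_lt_top fun i _ => ENNReal.ofReal_lt_top).ne

theorem two_sub_two_mul_cos_nonneg (t : ℝ) : 0 ≤ 2 - 2 * Real.cos t := by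
  linarith [Real.cos_le_one t]

theorem sq_min_le_two_sub_two_mul_cos {t : ℝ} (h0 : 0 ≤ t) (h1 : t ≤ 1) :
    16 * (min t (1 - t)) ^ 2 ≤ 2 - 2 * Real.cos (2 * π * t) := by
  have key : ∀ s : ℝ, 0 ≤ s → s ≤ 1 / 2 → 16 * s ^ 2 ≤ 2 - 2 * Real.cos (2 * π * s) := by
    intro s hs0 hs1
    have h : 2 * s ≤ Real.sin (π * s) := by
      have := Real.mul_le_sin (x := π * s) (by positivity) (by nlinarith [Real.pi_pos])
      have e : 2 / π * (π * s) = 2 * s := by field_simp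
      rwa [e] at this
    have h2 : Real.cos (2 * π * s) = 1 - 2 * Real.sin (π * s) ^ 2 := by
      rw [mul_assoc, Real.cos_two_mul, Real.cos_sq']
      ring
    nlinarith
  rcases le_total t (1 / 2) with h | h
  · rw [min_eq_left (by linarith)]
    exact key t h0 h
  · rw [min_eq_right (by linarith)]
    have := key (1 - t) (by linarith) (by linarith)
    rwa [mul_sub, mul_one, Real.cos_two_pi_sub] at this

theorem half_min_le_min_floor_div {x : ℝ} (hx0 : 0 < x) (hx1 : x < 1) {L : ℕ} (hL : 0 < L)
    (h : ⌊x * L⌋₊ ≠ 0) :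
    min x (1 - x) / 2 ≤ min ((⌊x * L⌋₊ : ℝ) / L) (1 - ⌊x * L⌋₊ / L) := by
  have hL' : (0 : ℝ) < L := by exact_mod_cast hL
  have h1 : (1 : ℝ) ≤ ⌊x * L⌋₊ := by exact_mod_cast Nat.one_le_iff_ne_zero.2 h
  have h2 : (⌊x * L⌋₊ : ℝ) ≤ x * L := Nat.floor_le (by positivity)
  have h3 : x * L < ⌊x * L⌋₊ + 1 := Nat.lt_floor_add_one _
  refine le_min ?_ ?_
  · calc min x (1 - x) / 2 ≤ x / 2 := by gcongr; exact min_le_left _ _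
      _ ≤ _ := by rw [le_div_iff₀ hL']; linarith
  · have : (⌊x * L⌋₊ : ℝ) / L ≤ x := by rwa [div_le_iff₀ hL']
    have h4 := min_le_right x (1 - x)
    linarith

theorem inv_length_le_min_floor_div {x : ℝ} (hx0 : 0 < x) (hx1 : x < 1) {L : ℕ} (hL : 0 < L)
    (h : ⌊x * L⌋₊ ≠ 0) :
    1 / (L : ℝ) ≤ min ((⌊x * L⌋₊ : ℝ) / L) (1 - ⌊x * L⌋₊ / L) := by
  have hL' : (0 : ℝ) < L := by exact_mod_cast hL
  have h1 : (1 : ℝ) ≤ ⌊x * L⌋₊ := by exact_mod_cast Nat.one_le_iff_ne_zero.2 h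
  have h2 : ⌊x * L⌋₊ < L := by
    rw [Nat.floor_lt (by positivity)]
    nlinarith
  have h3 : (⌊x * L⌋₊ + 1 : ℝ) ≤ L := by exact_mod_cast h2
  refine le_min (by gcongr) ?_
  rw [le_sub_iff_add_le, ← add_div, div_le_one hL']
  linarith

theorem sq_min_le_sum_two_sub_two_mul_cos_floor {d L : ℕ} (hL : 0 < L) {x : Fin d → ℝ}
    (hx : ∀ i, x i ∈ Set.Ioo (0 : ℝ) 1) (h : ∃ i, ⌊x i * L⌋₊ ≠ 0) (j : Fin d) :
    (min (x j) (1 - x j)) ^ 2 ≤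
      ∑ i, (2 - 2 * Real.cos (2 * π * (⌊x i * L⌋₊ : ℝ) / L)) := by
  have hL' : (0 : ℝ) < L := by exact_mod_cast hL
  have hmin : 0 < min (x j) (1 - x j) := lt_min (hx j).1 (by linarith [(hx j).2])
  have bound : ∀ i, ∀ c : ℝ, 0 ≤ c → c ≤ min ((⌊x i * L⌋₊ : ℝ) / L) (1 - ⌊x i * L⌋₊ / L) →
      16 * c ^ 2 ≤ ∑ i, (2 - 2 * Real.cos (2 * π * (⌊x i * L⌋₊ : ℝ) / L)) := by
    intro i c hc0 hc
    have h1 : (⌊x i * L⌋₊ : ℝ) / L ≤ 1 := by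
      have := min_le_right ((⌊x i * L⌋₊ : ℝ) / L) (1 - ⌊x i * L⌋₊ / L)
      linarith
    have h2 := sq_min_le_two_sub_two_mul_cos (t := (⌊x i * L⌋₊ : ℝ) / L) (by positivity) h1
    have h3 := Finset.single_le_sum
      (f := fun i => 2 - 2 * Real.cos (2 * π * (⌊x i * L⌋₊ : ℝ) / L))
      (fun i _ => two_sub_two_mul_cos_nonneg _) (Finset.mem_univ i)
    calc 16 * c ^ 2 ≤ 16 * (min ((⌊x i * L⌋₊ : ℝ) / L) (1 - ⌊x i * L⌋₊ / L)) ^ 2 := by gcongr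
      _ ≤ _ := h2
      _ = 2 - 2 * Real.cos (2 * π * (⌊x i * L⌋₊ : ℝ) / L) := by rw [mul_div_assoc]
      _ ≤ _ := h3
  by_cases hj : ⌊x j * L⌋₊ = 0
  · obtain ⟨i, hi⟩ := h
    have h1 := bound i (1 / L) (by positivity)
      (inv_length_le_min_floor_div (hx i).1 (hx i).2 hL hi)
    have h2 : x j ≤ 1 / L := by
      rw [le_div_iff₀ hL']
      exact (Nat.floor_eq_zero.1 hj).le
    have h3 : (min (x j) (1 - x j)) ^ 2 ≤ (1 / (L : ℝ)) ^ 2 := by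
      gcongr
      exact (min_le_left _ _).trans h2
    nlinarith [sq_nonneg (1 / (L : ℝ))]
  · have h1 := bound j (min (x j) (1 - x j) / 2) (by positivity)
      (half_min_le_min_floor_div (hx j).1 (hx j).2 hL hj)
    nlinarith [sq_nonneg (min (x j) (1 - x j))]

theorem rpow_neg_inv_le_of_sq_min_le {d : ℕ} {S y : ℝ} (hy0 : 0 < y) (hy1 : y < 1)
    (h : (min y (1 - y)) ^ 2 ≤ S) :
    S ^ (-(1 / d : ℝ)) ≤ y ^ (-(2 / d : ℝ)) + (1 - y) ^ (-(2 / d : ℝ)) := by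
  have key : ∀ z : ℝ, 0 < z → z ^ 2 ≤ S → S ^ (-(1 / d : ℝ)) ≤ z ^ (-(2 / d : ℝ)) := by
    intro z hz hzS
    calc S ^ (-(1 / d : ℝ)) ≤ (z ^ 2) ^ (-(1 / d : ℝ)) :=
          Real.rpow_le_rpow_of_nonpos (by positivity) hzS (by simp)
      _ = z ^ (-(2 / d : ℝ)) := by
          rw [← Real.rpow_natCast, ← Real.rpow_mul hz.le]
          congr 1
          push_cast
          ring
  have hy1' : 0 < 1 - y := by linarith
  have p1 := Real.rpow_nonneg hy0.le (-(2 / d : ℝ))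
  have p2 := Real.rpow_nonneg hy1'.le (-(2 / d : ℝ))
  rcases le_total y (1 - y) with hle | hle
  · rw [min_eq_left hle] at h
    linarith [key y hy0 h]
  · rw [min_eq_right hle] at h
    linarith [key (1 - y) hy1' h]

/-- A majorant, uniform in `L`, of the summands seen as step functions on the unit cube. -/
theorem norm_one_div_sum_floor_le {d : ℕ} (hd : d ≠ 0) (L : ℕ) {x : Fin d → ℝ}
    (hx : ∀ i, x i ∈ Set.Ioo (0 : ℝ) 1) :
    ‖1 / ∑ i, (2 - 2 * Real.cos (2 * π * (⌊x i * L⌋₊ : ℝ) / L))‖ ≤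
      ∏ i, ((x i) ^ (-(2 / d : ℝ)) + (1 - x i) ^ (-(2 / d : ℝ))) := by
  have hfac : ∀ i, 0 ≤ (x i) ^ (-(2 / d : ℝ)) + (1 - x i) ^ (-(2 / d : ℝ)) := fun i =>
    add_nonneg (Real.rpow_nonneg (hx i).1.le _)
      (Real.rpow_nonneg (by linarith [(hx i).2]) _)
  by_cases h : ∃ i, ⌊x i * L⌋₊ ≠ 0
  · have hL : 0 < L := by
      obtain ⟨i, hi⟩ := h
      rcases Nat.eq_zero_or_pos L with rfl | hL
      · simp at hi
      · exact hL
    have hS := sq_min_le_sum_two_sub_two_mul_cos_floor hL hx h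
    set S := ∑ i, (2 - 2 * Real.cos (2 * π * (⌊x i * L⌋₊ : ℝ) / L))
    have hS0 : 0 < S := by
      obtain ⟨i, -⟩ := h
      have : 0 < min (x i) (1 - x i) := lt_min (hx i).1 (by linarith [(hx i).2])
      exact (by positivity : 0 < (min (x i) (1 - x i)) ^ 2).trans_le (hS i)
    have hprod : 1 / S = ∏ _i : Fin d, S ^ (-(1 / d : ℝ)) := by
      have hd' : (d : ℝ) ≠ 0 := by exact_mod_cast hd
      rw [Finset.prod_const, Finset.card_univ, Fintype.card_fin, ← Real.rpow_natCast,
        ← Real.rpow_mul hS0.le, neg_mul, one_div_mul_cancel hd', Real.rpow_neg_one, one_div]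
    rw [Real.norm_of_nonneg (by positivity), hprod]
    exact Finset.prod_le_prod (fun i _ => by positivity) fun i _ =>
      rpow_neg_inv_le_of_sq_min_le (hx i).1 (hx i).2 (hS i)
  · push Not at h
    simp only [h]
    simpa using Finset.prod_nonneg fun i _ => hfac i

theorem integrable_prod_rpow_add_rpow {d : ℕ} {r : ℝ} (hr : -1 < r) :
    IntegrableOn (fun x : Fin d → ℝ => ∏ i, ((x i) ^ r + (1 - x i) ^ r))
      (Set.univ.pi fun _ => Set.Ioo 0 1) := by
  rw [IntegrableOn, volume_pi, Measure.restrict_pi_pi]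
  refine Integrable.fintype_prod (f := fun _ t => t ^ r + (1 - t) ^ r) fun i => ?_
  have h1 : IntervalIntegrable (fun t : ℝ => t ^ r) volume 0 1 :=
    intervalIntegral.intervalIntegrable_rpow' hr
  have h2 : IntervalIntegrable (fun t : ℝ => (1 - t) ^ r) volume 0 1 := by
    simpa using (h1.comp_sub_left 1).symm
  exact (intervalIntegrable_iff_integrableOn_Ioo_of_le zero_le_one).1 (h1.add h2)

open scoped Pointwise in
theorem setIntegral_unitCube_comp_smul {d : ℕ} (f : (Fin d → ℝ) → ℝ) {c : ℝ} (hc : 0 < c) :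
    ∫ x in Set.univ.pi (fun _ : Fin d => Set.Ioo (0 : ℝ) 1), f (c • x) =
      1 / c ^ d * ∫ p in Set.univ.pi (fun _ : Fin d => Set.Icc (0 : ℝ) c), f p := by
  have hae : Set.univ.pi (fun _ : Fin d => Set.Ioo (0 : ℝ) 1) =ᵐ[volume]
      Set.univ.pi (fun _ : Fin d => Set.Icc (0 : ℝ) 1) := by
    rw [Set.pi_univ_Icc]
    exact Measure.univ_pi_Ioo_ae_eq_Icc
  have himage : c • Set.univ.pi (fun _ : Fin d => Set.Icc (0 : ℝ) 1) =
      Set.univ.pi (fun _ : Fin d => Set.Icc (0 : ℝ) c) := by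
    rw [smul_univ_pi]
    congr 1
    funext i
    show c • Set.Icc (0 : ℝ) 1 = Set.Icc 0 c
    rw [LinearOrderedField.smul_Icc hc]
    simp
  rw [setIntegral_congr_set hae, Measure.setIntegral_comp_smul _ _ _ hc.ne', himage,
    Module.finrank_fin_fun, abs_of_pos (by positivity), smul_eq_mul, one_div]

theorem tendsto_one_div_sum_floor {d : ℕ} (hd : d ≠ 0) {x : Fin d → ℝ}
    (hx : ∀ i, x i ∈ Set.Ioo (0 : ℝ) 1) :
    Tendsto (fun L : ℕ => 1 / ∑ i, (2 - 2 * Real.cos (2 * π * (⌊x i * L⌋₊ : ℝ) / L))) atTop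
      (nhds (1 / ∑ i, (2 - 2 * Real.cos (((2 * π) • x) i)))) := by
  have hpos : 0 < ∑ i, (2 - 2 * Real.cos (((2 * π) • x) i)) := by
    have : NeZero d := ⟨hd⟩
    refine Finset.sum_pos (fun i _ => ?_) Finset.univ_nonempty
    have h := sq_min_le_two_sub_two_mul_cos (hx i).1.le (hx i).2.le
    have h' : 0 < min (x i) (1 - x i) := lt_min (hx i).1 (by linarith [(hx i).2])
    exact (by positivity : 0 < 16 * (min (x i) (1 - x i)) ^ 2).trans_le h
  refine tendsto_const_nhds.div (tendsto_finsetSum _ fun i _ => ?_) hpos.ne'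
  have h := (tendsto_nat_floor_mul_div_atTop (hx i).1.le).comp
    (tendsto_natCast_atTop_atTop (R := ℝ))
  have hcos := (Real.continuous_cos.tendsto _).comp (h.const_mul (2 * π))
  refine (((hcos.const_mul 2).const_sub 2).congr fun L => ?_)
  simp only [Function.comp_apply, mul_div_assoc]

/-- **Toy model, `d ≥ 3`: convergence of the normalized Laplacian trace.** For `d ≥ 3`, the
normalized sum over the nonzero eigenvalues of the Laplacian of the `d`-dimensional discrete
torus of side `L` converges, as `L → ∞`, to the finite limit
`C(d) = ⨍_{[0,2π]^d} (Σᵢ (2 − 2cos pᵢ))⁻¹ dp` (integral with respect to normalized Lebesgue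
measure). -/
theorem torus_laplacian_trace_tendsto (d : ℕ) (hd : 3 ≤ d) :
    Tendsto
      (fun L : ℕ =>
        ((1 : ℝ) / (L : ℝ) ^ d) *
          ∑ n ∈ (Fintype.piFinset fun _ : Fin d => Finset.range L).erase 0,
            1 / ∑ i, (2 - 2 * Real.cos (2 * π * n i / L)))
      atTop
      (nhds ((1 / (2 * π) ^ d) *
        ∫ p in Set.univ.pi (fun _ : Fin d => Set.Icc (0 : ℝ) (2 * π)),
          1 / ∑ i, (2 - 2 * Real.cos (p i)))) := by
  have hd0 : d ≠ 0 := by omega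
  have hd3 : (3 : ℝ) ≤ d := by exact_mod_cast hd
  rw [← setIntegral_unitCube_comp_smul (fun p => 1 / ∑ i, (2 - 2 * Real.cos (p i)))
    Real.two_pi_pos]
  have hmeas : MeasurableSet (Set.univ.pi (fun _ : Fin d => Set.Ioo (0 : ℝ) 1)) :=
    MeasurableSet.univ_pi fun _ => measurableSet_Ioo
  have hlim : Tendsto
      (fun L : ℕ => ∫ x in Set.univ.pi (fun _ : Fin d => Set.Ioo (0 : ℝ) 1),
        1 / ∑ i, (2 - 2 * Real.cos (2 * π * (⌊x i * L⌋₊ : ℝ) / L)))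
      atTop
      (nhds (∫ x in Set.univ.pi (fun _ : Fin d => Set.Ioo (0 : ℝ) 1),
        1 / ∑ i, (2 - 2 * Real.cos (((2 * π) • x) i)))) := by
    refine tendsto_integral_of_dominated_convergence
      (fun x => ∏ i, ((x i) ^ (-(2 / d : ℝ)) + (1 - x i) ^ (-(2 / d : ℝ))))
      (fun L => Measurable.aestronglyMeasurable (by fun_prop))
      (integrable_prod_rpow_add_rpow ?_) (fun L => ?_) ?_
    · rw [neg_lt_neg_iff, div_lt_one (by linarith)]
      linarith
    · filter_upwards [ae_restrict_mem hmeas] with x hx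
      exact norm_one_div_sum_floor_le hd0 L fun i => hx i trivial
    · filter_upwards [ae_restrict_mem hmeas] with x hx
      exact tendsto_one_div_sum_floor hd0 fun i => hx i trivial
  refine hlim.congr' ?_
  filter_upwards [eventually_gt_atTop 0] with L hL
  have hae : Set.univ.pi (fun _ : Fin d => Set.Ioo (0 : ℝ) 1) =ᵐ[volume]
      Set.univ.pi (fun _ : Fin d => Set.Ico (0 : ℝ) 1) :=
    Measure.univ_pi_Ioo_ae_eq_Icc.trans Measure.univ_pi_Ico_ae_eq_Icc.symm
  rw [setIntegral_congr_set hae, Finset.sum_erase _ (by simp)]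
  exact setIntegral_unitCube_comp_floor hL
    (fun n => 1 / ∑ i, (2 - 2 * Real.cos (2 * π * n i / L)))
end
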